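/- Let $k$ be a field, $R = k[x,y,z,t]$ the polynomial ring in four variables, and $n \geq 1$ an integer. Let $M_1$ be the cokernel of the $R$-linear map $R \to R^{n+2}$, $1 \mapsto (x^n, x^{n-1}y, \dots, x^{n-j}y^{j}, \dots, y^n, zt-1)$, and $M_2$ the cokernel of the $R$-linear map $R \to R^{n+2}$, $1 \mapsto (zx^n, x^{n-1}y, \dots, y^n, zt-1)$. Then $M_1$ and $M_2$ are reflexive $R$-modules of rank $n+1$ with $M_1 \oplus R \cong M_2 \oplus R$, but $M_1$ and $M_2$ are not isomorphic as $R$-modules. -/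

import Mathlib

open TensorProduct MvPolynomial

/-- The polynomial ring `k[x,y,z,t]`. -/
abbrev R4 (k : Type) [Field k] : Type := MvPolynomial (Fin 4) k

/-- The cokernel of `R → R^m`, `1 ↦ v`. -/
abbrev CokerVec (k : Type) [Field k] (m : ℕ) (v : Fin m → R4 k) : Type :=
  (Fin m → R4 k) ⧸ Submodule.span (R4 k) {v}

/-- The vector `(xⁿ, xⁿ⁻¹y, …, yⁿ, zt-1)`. -/
noncomputable def vec1 (k : Type) [Field k] (n : ℕ) : Fin (n + 2) → R4 k :=
  fun i => if (i : ℕ) ≤ n then (X 0) ^ (n - (i : ℕ)) * (X 1) ^ (i : ℕ)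
    else X 2 * X 3 - 1

/-- The vector `(zxⁿ, xⁿ⁻¹y, …, yⁿ, zt-1)`. -/
noncomputable def vec2 (k : Type) [Field k] (n : ℕ) : Fin (n + 2) → R4 k :=
  fun i => if (i : ℕ) = 0 then X 2 * (X 0) ^ n else vec1 k n i

set_option linter.unusedSectionVars false

section general
variable {R : Type} [CommRing R] [IsDomain R] {ι : Type} [Fintype ι] [DecidableEq ι]

/-- The Koszul functional `v s e_t - v t e_s` on the cokernel. -/
noncomputable def kosz (v : ι → R) (s t : ι) :
    Module.Dual R ((ι → R) ⧸ Submodule.span R {v}) :=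
  (Submodule.span R {v}).liftQ
    (v s • (LinearMap.proj t : (ι → R) →ₗ[R] R) - v t • (LinearMap.proj s : (ι → R) →ₗ[R] R)) (by
      rw [Submodule.span_singleton_le_iff_mem, LinearMap.mem_ker]
      simp [mul_comm])

lemma kosz_mk (v : ι → R) (s t : ι) (p : ι → R) :
    kosz v s t (Submodule.Quotient.mk p) = v s * p t - v t * p s := by
  simp [kosz, Submodule.liftQ_apply]

lemma dual_sum (v : ι → R) (f : Module.Dual R ((ι → R) ⧸ Submodule.span R {v})) (p : ι → R) :
    f (Submodule.Quotient.mk p) = ∑ t, p t * f (Submodule.Quotient.mk (Pi.single t 1)) := by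
  have : p = ∑ t, p t • (Pi.single t 1 : ι → R) := by
    ext i; simp [Finset.sum_apply, Pi.single_apply]
  conv_lhs => rw [this]
  rw [← Submodule.mkQ_apply, map_sum, map_sum]
  simp

lemma dual_v (v : ι → R) (f : Module.Dual R ((ι → R) ⧸ Submodule.span R {v})) :
    ∑ t, v t * f (Submodule.Quotient.mk (Pi.single t 1)) = 0 := by
  rw [← dual_sum]
  rw [(Submodule.Quotient.mk_eq_zero _).2 (Submodule.mem_span_singleton_self v), map_zero]

lemma dual_kosz (v : ι → R) (f : Module.Dual R ((ι → R) ⧸ Submodule.span R {v})) (i : ι) :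
    v i • f = ∑ t, f (Submodule.Quotient.mk (Pi.single t 1)) • kosz v i t := by
  ext x
  simp only [LinearMap.smul_apply, LinearMap.sum_apply, smul_eq_mul, LinearMap.comp_apply,
    Submodule.mkQ_apply, kosz_mk, mul_sub, Finset.sum_sub_distrib, LinearMap.coe_single]
  have h := dual_v v f
  have h1 : ∀ p : ι → R, ∑ t, f (Submodule.Quotient.mk (Pi.single t 1)) * (v t * p i) = 0 := by
    intro p
    calc _ = (∑ t, v t * f (Submodule.Quotient.mk (Pi.single t 1))) * p i := by
          rw [Finset.sum_mul]; exact Finset.sum_congr rfl fun _ _ => by ring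
      _ = 0 := by rw [h, zero_mul]
  rw [h1, sub_zero]
  rw [dual_sum, Finset.mul_sum]
  exact Finset.sum_congr rfl fun _ _ => by ring

lemma reflexive_coker (v : ι → R) (i j l : ι) (hi : v i ≠ 0)
    (H2 : ∀ p q, v i * p = v j * q → ∃ s, p = v j * s ∧ q = v i * s)
    (H1 : ∀ h p q, v l * h = v i * p + v j * q → ∃ p' q', h = v i * p' + v j * q') :
    Module.IsReflexive R ((ι → R) ⧸ Submodule.span R {v}) := by
  constructor
  constructor
  · rw [injective_iff_map_eq_zero]
    intro m hm
    obtain ⟨p, rfl⟩ := Submodule.Quotient.mk_surjective _ m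
    have hk : ∀ t, v i * p t - v t * p i = 0 := by
      intro t
      rw [← kosz_mk]
      exact congrArg (fun g => g (kosz v i t)) hm
    obtain ⟨s, h1, h2⟩ := H2 (p j) (p i) (sub_eq_zero.1 (hk j))
    rw [Submodule.Quotient.mk_eq_zero, Submodule.mem_span_singleton]
    refine ⟨s, ?_⟩
    ext t
    have := hk t
    rw [h2] at this
    have h3 : v i * (p t - s * v t) = 0 := by linear_combination this
    rcases mul_eq_zero.1 h3 with h | h
    · exact absurd h hi
    · simpa using (sub_eq_zero.1 h).symm
  · intro g
    have hrel : ∀ r s t, v r * g (kosz v s t) + v s * g (kosz v t r) + v t * g (kosz v r s) = 0 := by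
      intro r s t
      have : v r • kosz v s t + v s • kosz v t r + v t • kosz v r s = 0 := by
        ext x
        simp only [LinearMap.add_apply, LinearMap.smul_apply, smul_eq_mul, LinearMap.comp_apply,
          Submodule.mkQ_apply, kosz_mk, LinearMap.zero_apply]
        ring
      have h2 := congrArg g this
      simpa only [map_add, map_smul, smul_eq_mul, map_zero] using h2
    have hanti : ∀ s t, g (kosz v s t) = - g (kosz v t s) := by
      intro s t
      have : kosz v s t = - kosz v t s := by
        ext x
        simp only [LinearMap.neg_apply, LinearMap.comp_apply,
          Submodule.mkQ_apply, kosz_mk]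
        ring
      rw [this, map_neg]
    obtain ⟨pj, pi, hij⟩ := H1 (g (kosz v i j)) (- g (kosz v j l)) (- g (kosz v l i)) (by
      linear_combination hrel l i j)
    have hp : ∀ t, ∃ pt, g (kosz v i t) = v i * pt + v t * pi := by
      intro t
      obtain ⟨s, h1, h2⟩ := H2 (g (kosz v j t) + v t * pj) (- v t * pi - g (kosz v t i)) (by
        linear_combination hrel i j t - v t * hij)
      exact ⟨s, by rw [hanti]; linear_combination h2⟩
    choose p hp using hp
    refine ⟨Submodule.Quotient.mk p, ?_⟩
    ext f
    rw [Module.Dual.eval_apply]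
    apply mul_left_cancel₀ hi
    have h := congrArg g (dual_kosz v f i)
    rw [map_smul, map_sum, smul_eq_mul] at h
    rw [h, dual_sum]
    simp only [map_smul, smul_eq_mul, hp, mul_add, Finset.sum_add_distrib, Finset.mul_sum]
    have h0 : ∑ t, f (Submodule.Quotient.mk (Pi.single t 1)) * (v t * pi) = 0 := by
      calc _ = (∑ t, v t * f (Submodule.Quotient.mk (Pi.single t 1))) * pi := by
            rw [Finset.sum_mul]; exact Finset.sum_congr rfl fun _ _ => by ring
        _ = 0 := by rw [dual_v, zero_mul]
    rw [h0, add_zero]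
    exact Finset.sum_congr rfl fun _ _ => by ring

lemma rank_coker (n : ℕ) (v : Fin (n + 2) → R) (hv : v ≠ 0) :
    Module.rank (FractionRing R)
      (FractionRing R ⊗[R] ((Fin (n + 2) → R) ⧸ Submodule.span R {v})) = n + 1 := by
  rw [IsFractionRing.rank_right_eq R,
    IsLocalizedModule.rank_eq (nonZeroDivisors R) le_rfl
      (TensorProduct.mk R (FractionRing R) ((Fin (n + 2) → R) ⧸ Submodule.span R {v}) 1)]
  have h := rank_quotient_add_rank_of_isDomain (Submodule.span R {v})
  have h1 : Module.rank R (Submodule.span R {v}) = 1 := by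
    rw [← (LinearEquiv.toSpanNonzeroSingleton R _ v hv).rank_eq, Module.rank_self]
  rw [h1, rank_fun'] at h
  rw [← Cardinal.add_one_inj, h]
  simp
  norm_num [add_assoc]

/-- Isomorphism of stabilised cokernels. -/
lemma stab_iso {N : Type} [AddCommGroup N] [Module R N] (v w : N) (e : (N × R) ≃ₗ[R] (N × R))
    (he : e (v, 0) = (w, 0)) :
    Nonempty (((N ⧸ Submodule.span R {v}) × R) ≃ₗ[R] ((N ⧸ Submodule.span R {w}) × R)) := by
  have key : ∀ u : N, ∃ q : (N × R) →ₗ[R] ((N ⧸ Submodule.span R {u}) × R),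
      Function.Surjective q ∧ LinearMap.ker q = Submodule.span R {(u, (0 : R))} := by
    intro u
    refine ⟨(Submodule.span R {u}).mkQ.prodMap LinearMap.id, ?_, ?_⟩
    · rintro ⟨a, b⟩
      obtain ⟨a, rfl⟩ := Submodule.mkQ_surjective _ a
      exact ⟨(a, b), rfl⟩
    · ext ⟨a, b⟩
      rw [LinearMap.mem_ker, Submodule.mem_span_singleton]
      rw [LinearMap.prodMap_apply, Prod.mk_eq_zero, Submodule.mkQ_apply,
        Submodule.Quotient.mk_eq_zero, Submodule.mem_span_singleton]
      simp only [Prod.smul_mk, smul_zero, Prod.mk.injEq, LinearMap.id_apply, exists_and_right]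
      exact and_congr_right fun _ => eq_comm
  obtain ⟨q1, s1, k1⟩ := key v
  obtain ⟨q2, s2, k2⟩ := key w
  refine ⟨(q1.quotKerEquivOfSurjective s1).symm.trans
    ((Submodule.Quotient.equiv _ _ e ?_).trans (q2.quotKerEquivOfSurjective s2))⟩
  rw [k1, k2, Submodule.map_span]
  simp [he]

end general

section specific
variable (k : Type) [Field k]

lemma vec1_zero (n : ℕ) : vec1 k n 0 = X 0 ^ n := by simp [vec1]
lemma vec1_y (n : ℕ) : vec1 k n (Fin.last n).castSucc = X 1 ^ n := by simp [vec1]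
lemma vec1_w (n : ℕ) : vec1 k n (Fin.last (n + 1)) = X 2 * X 3 - 1 := by simp [vec1]
lemma vec2_zero (n : ℕ) : vec2 k n 0 = X 2 * X 0 ^ n := by simp [vec2]
lemma vec2_ne (n : ℕ) (i : Fin (n + 2)) (hi : i ≠ 0) : vec2 k n i = vec1 k n i := by
  have : (i : ℕ) ≠ 0 := fun h => hi (Fin.ext h)
  simp [vec2, this]
lemma vec2_y (n : ℕ) (hn : 1 ≤ n) : vec2 k n (Fin.last n).castSucc = X 1 ^ n := by
  rw [vec2_ne, vec1_y]
  intro h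
  have := congrArg Fin.val h
  simp at this
  omega
lemma vec2_w (n : ℕ) : vec2 k n (Fin.last (n + 1)) = X 2 * X 3 - 1 := by
  rw [vec2_ne, vec1_w]
  intro h
  have := congrArg Fin.val h
  simp at this

lemma relprime_yw (n : ℕ) : IsRelPrime (X 1 ^ n : R4 k) (X 2 * X 3 - 1) := by
  apply IsRelPrime.pow_left
  have hX : Irreducible (X 1 : R4 k) := MvPolynomial.X_prime.irreducible
  rw [hX.isRelPrime_iff_not_dvd]
  rintro ⟨p, hp⟩
  have := congrArg (MvPolynomial.eval (fun _ => (0 : k))) hp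
  simp at this

lemma yn_ne (n : ℕ) : (X 1 ^ n : R4 k) ≠ 0 := pow_ne_zero _ (MvPolynomial.X_ne_zero _)

lemma w_ne : (X 2 * X 3 - 1 : R4 k) ≠ 0 := by
  intro h
  have := congrArg (MvPolynomial.eval (fun _ => (0 : k))) h
  simp at this

lemma cross_yw (n : ℕ) (p q : R4 k) (h : X 1 ^ n * p = (X 2 * X 3 - 1) * q) :
    ∃ s, p = (X 2 * X 3 - 1) * s ∧ q = X 1 ^ n * s := by
  have h1 : (X 2 * X 3 - 1 : R4 k) ∣ p :=
    (relprime_yw k n).symm.dvd_of_dvd_mul_left ⟨q, h⟩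
  obtain ⟨s, rfl⟩ := h1
  refine ⟨s, rfl, ?_⟩
  apply mul_left_cancel₀ (w_ne k)
  linear_combination - h

/-- Substitution `x = 0`. -/
noncomputable def sig : R4 k →ₐ[k] R4 k := aeval (fun i => if i = 0 then 0 else X i)

lemma sig_dvd (p : R4 k) : ∃ q, p - sig k p = X 0 * q := by
  have h : (Ideal.Quotient.mkₐ k (Ideal.span {(X 0 : R4 k)})).comp (sig k) =
      Ideal.Quotient.mkₐ k (Ideal.span {(X 0 : R4 k)}) := by
    apply MvPolynomial.algHom_ext
    intro i
    by_cases hi : i = 0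
    · subst hi
      simp only [AlgHom.comp_apply, sig, aeval_X, if_true, map_zero, Ideal.Quotient.mkₐ_eq_mk]
      exact (Ideal.Quotient.eq_zero_iff_mem.2 (Ideal.mem_span_singleton_self _)).symm
    · simp [sig, hi]
  have h2 := DFunLike.congr_fun h p
  simp only [AlgHom.comp_apply, Ideal.Quotient.mkₐ_eq_mk] at h2
  exact Ideal.mem_span_singleton.1 (Ideal.Quotient.eq.1 h2.symm)

lemma reg_x (n : ℕ) (h p q : R4 k) (hh : X 0 * h = X 1 ^ n * p + (X 2 * X 3 - 1) * q) :
    ∃ p' q', h = X 1 ^ n * p' + (X 2 * X 3 - 1) * q' := by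
  obtain ⟨p', hp⟩ := sig_dvd k p
  obtain ⟨q', hq⟩ := sig_dvd k q
  refine ⟨p', q', mul_left_cancel₀ (MvPolynomial.X_ne_zero (0 : Fin 4)) ?_⟩
  have := congrArg (sig k) hh
  simp only [map_mul, map_add, map_sub, map_pow, map_one] at this
  have e0 : sig k (X 0) = 0 := by simp [sig]
  have e1 : sig k (X 1) = X 1 := by simp [sig]
  have e2 : sig k (X 2) = X 2 := by simp [sig]
  have e3 : sig k (X 3) = X 3 := by simp [sig]
  rw [e0, e1, e2, e3] at this
  linear_combination hh - this + X 1 ^ n * hp + (X 2 * X 3 - 1) * hq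

lemma reg_xn (n m : ℕ) (h p q : R4 k) (hh : X 0 ^ m * h = X 1 ^ n * p + (X 2 * X 3 - 1) * q) :
    ∃ p' q', h = X 1 ^ n * p' + (X 2 * X 3 - 1) * q' := by
  induction m generalizing p q with
  | zero => exact ⟨p, q, by simpa using hh⟩
  | succ m ih =>
    obtain ⟨p', q', h'⟩ := reg_x k n (X 0 ^ m * h) p q (by rw [← hh]; ring)
    exact ih _ _ h'

lemma refl1 (n : ℕ) : Module.IsReflexive (R4 k) (CokerVec k (n + 2) (vec1 k n)) := by
  apply reflexive_coker (vec1 k n) (Fin.last n).castSucc (Fin.last (n + 1)) 0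
  · rw [vec1_y]; exact yn_ne k n
  · rw [vec1_y, vec1_w]; exact cross_yw k n
  · rw [vec1_y, vec1_w, vec1_zero]; exact reg_xn k n n

lemma refl2 (n : ℕ) (hn : 1 ≤ n) :
    Module.IsReflexive (R4 k) (CokerVec k (n + 2) (vec2 k n)) := by
  apply reflexive_coker (vec2 k n) (Fin.last n).castSucc (Fin.last (n + 1)) 0
  · rw [vec2_y k n hn]; exact yn_ne k n
  · rw [vec2_y k n hn, vec2_w]; exact cross_yw k n
  · rw [vec2_y k n hn, vec2_w, vec2_zero]
    intro h p q hh
    apply reg_xn k n n h (X 3 * p) (X 3 * q - X 0 ^ n * h)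
    linear_combination X 3 * hh

lemma stab (n : ℕ) : Nonempty (((CokerVec k (n + 2) (vec1 k n)) × R4 k) ≃ₗ[R4 k]
      ((CokerVec k (n + 2) (vec2 k n)) × R4 k)) := by
  have hl : Fin.last (n + 1) ≠ 0 := by
    intro h
    have := congrArg Fin.val h
    simp at this
  let w : R4 k := X 2 * X 3 - 1
  let e : ((Fin (n + 2) → R4 k) × R4 k) ≃ₗ[R4 k] ((Fin (n + 2) → R4 k) × R4 k) :=
    { toFun := fun p => (fun i => if i = 0 then X 2 * p.1 0 + w * p.2 else p.1 i,
        - w * p.1 0 + (X 3 - X 3 * w) * p.2 + X 0 ^ n * p.1 (Fin.last (n + 1)))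
      invFun := fun p => (fun i => if i = 0 then
          X 3 * p.1 0 - w * (p.2 + X 3 * p.1 0 - X 0 ^ n * p.1 (Fin.last (n + 1))) else p.1 i,
        - p.1 0 + X 2 * (p.2 + X 3 * p.1 0 - X 0 ^ n * p.1 (Fin.last (n + 1))))
      map_add' := by
        intro p q
        ext1
        · funext i
          by_cases hi : i = 0
          · simp [hi]; ring
          · simp [hi]
        · simp; ring
      map_smul' := by
        intro c p
        ext1
        · funext i
          by_cases hi : i = 0
          · simp [hi]; ring
          · simp [hi]
        · simp; ring
      left_inv := by
        intro p
        ext1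
        · funext i
          by_cases hi : i = 0
          · simp [hi, hl, w]; ring
          · simp [hi]
        · simp [hl, w]; ring
      right_inv := by
        intro p
        ext1
        · funext i
          by_cases hi : i = 0
          · simp [hi, w]; ring
          · simp [hi]
        · simp [hl, w]; ring }
  apply stab_iso (vec1 k n) (vec2 k n) e
  have : e (vec1 k n, 0) = (fun i => if i = 0 then X 2 * vec1 k n 0 + w * 0 else vec1 k n i,
        - w * vec1 k n 0 + (X 3 - X 3 * w) * 0 + X 0 ^ n * vec1 k n (Fin.last (n + 1))) := rfl
  rw [this]
  ext1
  · funext i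
    by_cases hi : i = 0
    · simp [hi, vec1_zero, vec2_zero]
    · simp [hi, vec2_ne]
  · simp [vec1_zero, vec1_w, w]; ring

end specific

section noniso
variable (k : Type) [Field k]

/-- The map `R → k(z)[x,y]`, `t ↦ 1/z`. -/
noncomputable def bigPsi : R4 k →ₐ[k] MvPolynomial (Fin 2) (RatFunc k) :=
  aeval ![X 0, X 1, MvPolynomial.C RatFunc.X, MvPolynomial.C (RatFunc.X)⁻¹]

/-- The map `R → k(z)`, `x, y ↦ 0`, `t ↦ 1/z`. -/
noncomputable def psi : R4 k →+* RatFunc k :=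
  (constantCoeff (σ := Fin 2) (R := RatFunc k)).comp (bigPsi k).toRingHom

lemma bigPsi_X0 : bigPsi k (X 0) = X 0 := by simp [bigPsi]
lemma bigPsi_X1 : bigPsi k (X 1) = X 1 := by simp [bigPsi]
lemma bigPsi_X2 : bigPsi k (X 2) = MvPolynomial.C RatFunc.X := by simp [bigPsi]
lemma bigPsi_X3 : bigPsi k (X 3) = MvPolynomial.C (RatFunc.X)⁻¹ := by simp [bigPsi]
lemma bigPsi_w : bigPsi k (X 2 * X 3 - 1) = 0 := by
  rw [map_sub, map_mul, bigPsi_X2, bigPsi_X3, ← map_mul, mul_inv_cancel₀ RatFunc.X_ne_zero]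
  simp

lemma psi_apply (p : R4 k) : psi k p = constantCoeff (bigPsi k p) := rfl
lemma psi_X0 : psi k (X 0) = 0 := by simp [psi_apply, bigPsi_X0]
lemma psi_X1 : psi k (X 1) = 0 := by simp [psi_apply, bigPsi_X1]
lemma psi_X2 : psi k (X 2) = RatFunc.X := by simp [psi_apply, bigPsi_X2]
lemma psi_X3 : psi k (X 3) = (RatFunc.X)⁻¹ := by simp [psi_apply, bigPsi_X3]
lemma psi_w : psi k (X 2 * X 3 - 1) = 0 := by rw [psi_apply, bigPsi_w, map_zero]
lemma psi_C (a : k) : psi k (MvPolynomial.C a) = RatFunc.C a := by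
  rw [psi_apply, ← MvPolynomial.algebraMap_eq, AlgHom.commutes]
  rw [IsScalarTower.algebraMap_apply k (RatFunc k), MvPolynomial.algebraMap_eq, constantCoeff_C]
  rfl

/-- Substitution `x = y = 0`. -/
noncomputable def tau : R4 k →ₐ[k] R4 k := aeval ![0, 0, X 2, X 3]

lemma psi_tau (p : R4 k) : psi k (tau k p) = psi k p := by
  have : (psi k).comp (tau k).toRingHom = psi k := by
    apply MvPolynomial.ringHom_ext
    · intro a
      have : tau k (MvPolynomial.C a) = MvPolynomial.C a := by
        rw [← MvPolynomial.algebraMap_eq, AlgHom.commutes]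
      simp [this]
    · intro i
      fin_cases i <;> simp [tau, psi_X0, psi_X1]
  exact RingHom.congr_fun this p

lemma psi_vec1 (n : ℕ) (hn : 1 ≤ n) (s : Fin (n + 2)) : psi k (vec1 k n s) = 0 := by
  unfold vec1
  split_ifs with h
  · rw [map_mul, map_pow, map_pow, psi_X0, psi_X1, ← pow_add]
    exact zero_pow (by omega)
  · exact psi_w k

lemma vec1_castSucc (n : ℕ) (s : Fin (n + 1)) :
    vec1 k n s.castSucc = X 0 ^ (n - (s : ℕ)) * X 1 ^ (s : ℕ) := by
  have : (s : ℕ) ≤ n := by omega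
  simp [vec1, this]

lemma coeff_aux {F : Type} [Field F] (n : ℕ) (P : Fin (n + 1) → MvPolynomial (Fin 2) F)
    (h : ∑ s, P s * (X 0 ^ (n - (s : ℕ)) * X 1 ^ (s : ℕ)) = 0) (j : Fin (n + 1)) :
    constantCoeff (P j) = 0 := by
  let e : Fin (n + 1) → (Fin 2 →₀ ℕ) := fun s =>
    Finsupp.single 0 (n - (s : ℕ)) + Finsupp.single 1 (s : ℕ)
  have hm : ∀ s : Fin (n + 1), (X 0 ^ (n - (s : ℕ)) * X 1 ^ (s : ℕ) : MvPolynomial (Fin 2) F)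
      = monomial (e s) 1 := by
    intro s
    rw [X_pow_eq_monomial, X_pow_eq_monomial, monomial_mul, one_mul]
  simp only [hm] at h
  have h2 := congrArg (coeff (e j)) h
  rw [coeff_sum, Finset.sum_eq_single j] at h2
  · rw [coeff_mul_monomial', if_pos le_rfl] at h2
    simpa [constantCoeff_eq] using h2
  · intro s _ hs
    rw [coeff_mul_monomial', if_neg]
    intro hle
    have h0 := hle 0
    have h1 := hle 1
    simp [e] at h0 h1
    apply hs
    apply Fin.ext
    have := Fin.le_def.1 h1
    omega
  · simp

lemma syz (n : ℕ) (hn : 1 ≤ n) (a : Fin (n + 2) → R4 k) (h : ∑ s, a s * vec1 k n s = 0)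
    (s : Fin (n + 2)) : psi k (a s) = 0 := by
  rw [Fin.sum_univ_castSucc] at h
  change _ + a (Fin.last (n + 1)) * vec1 k n (Fin.last (n + 1)) = 0 at h
  rw [vec1_w] at h
  simp only [vec1_castSucc] at h
  refine Fin.lastCases ?_ ?_ s
  · have h2 := congrArg (tau k) h
    rw [map_add, map_sum, map_mul, map_zero, Finset.sum_eq_zero, zero_add] at h2
    · have hw : tau k (X 2 * X 3 - 1) = X 2 * X 3 - 1 := by simp [tau]
      rw [hw] at h2
      rcases mul_eq_zero.1 h2 with h3 | h3
      · rw [← psi_tau, h3, map_zero]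
      · exact absurd h3 (w_ne k)
    · intro i _
      have h0 : tau k (X 0) = 0 := by simp [tau]
      have h1 : tau k (X 1) = 0 := by simp [tau]
      rw [map_mul, map_mul, map_pow, map_pow, h0, h1, ← pow_add, zero_pow (by omega), mul_zero]
  · intro j
    have h2 := congrArg (bigPsi k) h
    rw [map_add, map_mul, bigPsi_w, mul_zero, add_zero, map_zero, map_sum] at h2
    simp only [map_mul, map_pow, bigPsi_X0, bigPsi_X1] at h2
    exact coeff_aux n (fun s => bigPsi k (a s.castSucc)) h2 j

lemma det_dvd (n m : ℕ) (A : Matrix (Fin m) (Fin m) (R4 k)) (c : R4 k) (hc : c ≠ 0)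
    (v v' : Fin m → R4 k) (hA : A.mulVec v = c • v') (i j : Fin m) (hi : v i = X 1 ^ n)
    (hj : v j = X 2 * X 3 - 1) : ∃ u, A.det = c * u := by
  have h1 : A.det • v = c • (A.adjugate.mulVec v') := by
    rw [← Matrix.mulVec_smul, ← hA, Matrix.mulVec_mulVec, Matrix.adjugate_mul, Matrix.smul_mulVec,
      Matrix.one_mulVec]
  have h2 : ∀ t, A.det * v t = c * A.adjugate.mulVec v' t := fun t => congrFun h1 t
  have hqi := h2 i
  have hqj := h2 j
  rw [hi] at hqi
  rw [hj] at hqj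
  obtain ⟨s, hs1, hs2⟩ := cross_yw k n (A.adjugate.mulVec v' j) (A.adjugate.mulVec v' i) (by
    apply mul_left_cancel₀ hc
    linear_combination (X 2 * X 3 - 1) * hqi - X 1 ^ n * hqj)
  refine ⟨s, mul_right_cancel₀ (yn_ne k n) ?_⟩
  rw [hqi, hs2]; ring

lemma lift_map {R : Type} [CommRing R] {m : ℕ} (v w : Fin m → R)
    (f : ((Fin m → R) ⧸ Submodule.span R {v}) →ₗ[R] ((Fin m → R) ⧸ Submodule.span R {w})) :
    ∃ (A : Matrix (Fin m) (Fin m) R) (c : R), A.mulVec v = c • w ∧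
      ∀ p, f (Submodule.Quotient.mk p) = Submodule.Quotient.mk (A.mulVec p) := by
  obtain ⟨h, hh⟩ := Module.projective_lifting_property (Submodule.span R {w}).mkQ
    (f ∘ₗ (Submodule.span R {v}).mkQ) (Submodule.mkQ_surjective _)
  have h1 : ∀ p, f (Submodule.Quotient.mk p) =
      Submodule.Quotient.mk ((LinearMap.toMatrix' h).mulVec p) := by
    intro p
    rw [← Matrix.toLin'_apply, Matrix.toLin'_toMatrix']
    exact (LinearMap.congr_fun hh p).symm
  have h2 := h1 v
  rw [(Submodule.Quotient.mk_eq_zero _).2 (Submodule.mem_span_singleton_self v), map_zero, eq_comm,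
    Submodule.Quotient.mk_eq_zero, Submodule.mem_span_singleton] at h2
  obtain ⟨c, hc⟩ := h2
  exact ⟨_, c, hc.symm, h1⟩

lemma noniso (n : ℕ) (hn : 1 ≤ n) : IsEmpty ((CokerVec k (n + 2) (vec1 k n)) ≃ₗ[R4 k]
      (CokerVec k (n + 2) (vec2 k n))) := by
  constructor
  intro φ
  obtain ⟨A, c, hA, hA'⟩ := lift_map (vec1 k n) (vec2 k n) φ.toLinearMap
  obtain ⟨B, d, hB, hB'⟩ := lift_map (vec2 k n) (vec1 k n) φ.symm.toLinearMap
  have hBA : ∀ p, ∃ l : R4 k, (B * A).mulVec p = p + l • vec1 k n := by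
    intro p
    have h1 : (Submodule.Quotient.mk ((B * A).mulVec p) : CokerVec k (n + 2) (vec1 k n)) =
        Submodule.Quotient.mk p := by
      rw [← Matrix.mulVec_mulVec, ← hB', ← hA']
      simp
    rw [Submodule.Quotient.eq, Submodule.mem_span_singleton] at h1
    obtain ⟨l, hl⟩ := h1
    exact ⟨l, by rw [hl]; abel⟩
  choose l hl using fun i => hBA (Pi.single i 1)
  have hBA2 : B * A = 1 + Matrix.replicateCol Unit (vec1 k n) * Matrix.replicateRow Unit l := by
    ext i j
    have := congrFun (hl j) i
    rw [Matrix.mulVec_single_one] at this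
    simp only [Matrix.col_apply, Pi.add_apply, Pi.smul_apply, smul_eq_mul] at this
    rw [this]
    simp [Matrix.mul_apply, Matrix.one_apply, Pi.single_apply, mul_comm]
  have hdet : B.det * A.det = 1 + l ⬝ᵥ vec1 k n := by
    rw [← Matrix.det_mul, hBA2, Matrix.det_one_add_replicateCol_mul_replicateRow]
  have hcd : c * d = 1 + l ⬝ᵥ vec1 k n := by
    have h1 : (B * A).mulVec (vec1 k n) = (c * d) • vec1 k n := by
      rw [← Matrix.mulVec_mulVec, hA, Matrix.mulVec_smul, hB, smul_smul]
    rw [hBA2] at h1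
    have h2 := congrFun h1 (Fin.last (n + 1))
    simp only [Matrix.add_mulVec, Matrix.one_mulVec, ← Matrix.mulVec_mulVec, Pi.add_apply,
      Pi.smul_apply, smul_eq_mul] at h2
    have h3 : (Matrix.replicateCol Unit (vec1 k n)).mulVec
        ((Matrix.replicateRow Unit l).mulVec (vec1 k n)) (Fin.last (n + 1))
        = vec1 k n (Fin.last (n + 1)) * (l ⬝ᵥ vec1 k n) := by
      simp [Matrix.mulVec, dotProduct]
    rw [h3, vec1_w] at h2
    apply mul_right_cancel₀ (w_ne k)
    linear_combination - h2
  have hpsi : psi k c * psi k d = 1 := by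
    rw [← map_mul, hcd, map_add, map_one, dotProduct, map_sum, Finset.sum_eq_zero, add_zero]
    intro i _
    rw [map_mul, psi_vec1 k n hn, mul_zero]
  have hpc : psi k c ≠ 0 := left_ne_zero_of_mul_eq_one hpsi
  have hpd : psi k d ≠ 0 := right_ne_zero_of_mul_eq_one hpsi
  have hc : c ≠ 0 := fun h => hpc (by rw [h, map_zero])
  have hd : d ≠ 0 := fun h => hpd (by rw [h, map_zero])
  obtain ⟨u, hu⟩ := det_dvd k n _ A c hc _ _ hA _ _ (vec1_y k n) (vec1_w k n)
  obtain ⟨u', hu'⟩ := det_dvd k n _ B d hd _ _ hB _ _ (vec2_y k n hn) (vec2_w k n)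
  have huu : u * u' = 1 := by
    apply mul_left_cancel₀ (mul_ne_zero hc hd)
    rw [hu, hu', ← hcd] at hdet
    linear_combination hdet
  obtain ⟨a, ha, rfl⟩ := MvPolynomial.isUnit_iff_eq_C_of_isReduced.1 (IsUnit.of_mul_eq_one _ huu)
  -- reduce A modulo (x, y, zt - 1)
  let D : Fin (n + 2) → R4 k := fun i => if i = 0 then X 2 else 1
  have hv2 : ∀ i, vec2 k n i = D i * vec1 k n i := by
    intro i
    by_cases hi : i = 0
    · subst hi; simp [D, vec1_zero, vec2_zero]
    · simp [D, hi, vec2_ne]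
  have hAmod : (psi k).mapMatrix A = Matrix.diagonal (fun i => psi k (c * D i)) := by
    ext r s
    have h1 := syz k n hn (fun s => A r s - Matrix.diagonal (fun i => c * D i) r s) (by
      have h2 := congrFun hA r
      simp only [Matrix.mulVec, dotProduct, Pi.smul_apply, smul_eq_mul] at h2
      simp only [sub_mul, Finset.sum_sub_distrib, h2, hv2]
      rw [Finset.sum_eq_single r]
      · simp; ring
      · intro b _ hb
        rw [Matrix.diagonal_apply_ne _ hb.symm, zero_mul]
      · simp) s
    simp only [map_sub] at h1
    rw [RingHom.mapMatrix_apply, Matrix.map_apply, sub_eq_zero.1 h1]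
    by_cases hrs : r = s
    · subst hrs; simp
    · simp [Matrix.diagonal_apply_ne _ hrs]
  have hfin : psi k c * RatFunc.C a = psi k c ^ (n + 2) * RatFunc.X := by
    rw [← psi_C, ← map_mul, ← hu, RingHom.map_det, hAmod, Matrix.det_diagonal]
    simp only [map_mul, Finset.prod_mul_distrib, Finset.prod_const, Finset.card_univ,
      Fintype.card_fin]
    congr 1
    rw [Finset.prod_eq_single 0]
    · simp [D, psi_X2]
    · intro b _ hb; simp [D, hb]
    · simp
  have hCa : RatFunc.C a ≠ 0 := by
    rw [Ne, map_eq_zero]; exact ha.ne_zero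
  have hpow : ∀ m : ℕ, (psi k c ^ m).intDegree = m * (psi k c).intDegree := by
    intro m
    induction m with
    | zero => simp
    | succ m ih =>
      rw [pow_succ, RatFunc.intDegree_mul (pow_ne_zero _ hpc) hpc, ih]; push_cast; ring
  have hdeg := congrArg RatFunc.intDegree hfin
  rw [RatFunc.intDegree_mul hpc hCa, RatFunc.intDegree_mul (pow_ne_zero _ hpc) RatFunc.X_ne_zero,
    hpow, RatFunc.intDegree_C, RatFunc.intDegree_X] at hdeg
  have h5 : ((n : ℤ) + 1) * (- (psi k c).intDegree) = 1 := by
    push_cast at hdeg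
    linear_combination hdeg
  have h6 : ((n : ℤ) + 1) ∣ 1 := ⟨_, h5.symm⟩
  have h7 := Int.le_of_dvd one_pos h6
  omega

end noniso
/-- Let `R = k[x,y,z,t]`, `n ≥ 1`, `M₁ = coker(1 ↦ (xⁿ, xⁿ⁻¹y, …, yⁿ, zt-1))` and
`M₂ = coker(1 ↦ (zxⁿ, xⁿ⁻¹y, …, yⁿ, zt-1))`.  Then `M₁` and `M₂` are reflexive of rank
`n+1`, are stably isomorphic (`M₁ ⊕ R ≅ M₂ ⊕ R`), but are not isomorphic. -/
theorem higher_rank_noncancellation (k : Type) [Field k] (n : ℕ) (hn : 1 ≤ n) :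
    Module.IsReflexive (R4 k) (CokerVec k (n + 2) (vec1 k n)) ∧
    Module.IsReflexive (R4 k) (CokerVec k (n + 2) (vec2 k n)) ∧
    Module.rank (FractionRing (R4 k))
      (FractionRing (R4 k) ⊗[R4 k] (CokerVec k (n + 2) (vec1 k n))) = n + 1 ∧
    Module.rank (FractionRing (R4 k))
      (FractionRing (R4 k) ⊗[R4 k] (CokerVec k (n + 2) (vec2 k n))) = n + 1 ∧
    Nonempty (((CokerVec k (n + 2) (vec1 k n)) × R4 k) ≃ₗ[R4 k]
      ((CokerVec k (n + 2) (vec2 k n)) × R4 k)) ∧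
    IsEmpty ((CokerVec k (n + 2) (vec1 k n)) ≃ₗ[R4 k]
      (CokerVec k (n + 2) (vec2 k n))) := by
  refine ⟨refl1 k n, refl2 k n hn, rank_coker n _ ?_, rank_coker n _ ?_, stab k n, noniso k n hn⟩
  · intro h
    have := congrFun h (Fin.last (n + 1))
    rw [vec1_w] at this
    exact w_ne k this
  · intro h
    have := congrFun h (Fin.last (n + 1))
    rw [vec2_w] at this
    exact w_ne k this
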